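/- Let μ, λ_0, λ_1, λ_2 ∈ ℂ with λ_1 ∉ ℤ_{≤0} and λ_2 ∉ ℤ_{≤0}, and let u(x,y) = Σ_{m,n≥0} [(μ)_{m+n}(λ_0)_{m+n}/((λ_1)_m(λ_2)_n m! n!)] x^m y^n (Appell's F_4 series), which converges absolutely on D = {(x,y) ∈ ℂ² : √|x| + √|y| < 1}. Then u is holomorphic on D and satisfies there the system (θ_x+θ_y+μ)(θ_x+θ_y+λ_0)u − ∂_x(θ_x+λ_1−1)u = 0 and (θ_x+θ_y+μ)(θ_x+θ_y+λ_0)u − ∂_y(θ_y+λ_2−1)u = 0, where ∂_x = ∂/∂x, ∂_y = ∂/∂y, θ_x = x∂_x, θ_y = y∂_y. -/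

import Mathlib

open Complex

noncomputable section

/-- The Pochhammer symbol `(a)ₖ = a(a+1)⋯(a+k-1)`. -/
def poch (a : ℂ) (k : ℕ) : ℂ := ∏ i ∈ Finset.range k, (a + i)

/-- Partial derivative in the first variable. -/
def dx (u : ℂ → ℂ → ℂ) (x y : ℂ) : ℂ := deriv (fun x' => u x' y) x

/-- Partial derivative in the second variable. -/
def dy (u : ℂ → ℂ → ℂ) (x y : ℂ) : ℂ := deriv (fun y' => u x y') y

/-- Euler operator `θ_x = x ∂_x`. -/
def thx (u : ℂ → ℂ → ℂ) (x y : ℂ) : ℂ := x * dx u x y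

/-- Euler operator `θ_y = y ∂_y`. -/
def thy (u : ℂ → ℂ → ℂ) (x y : ℂ) : ℂ := y * dy u x y

open Filter Topology

lemma poch_succ (a : ℂ) (k : ℕ) : poch a (k + 1) = poch a k * (a + k) :=
  Finset.prod_range_succ _ _

lemma exists_bound_of_eventually_ratio_le {f : ℕ → ℝ} {r : ℝ} (hf : ∀ k, 0 ≤ f k) (hr : r < 1)
    (h : ∀ᶠ k in atTop, f (k + 1) ≤ r * f k) : ∃ C, 0 ≤ C ∧ ∀ k, f k ≤ C := by
  have hs : Summable f := summable_of_ratio_norm_eventually_le hr <| by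
    filter_upwards [h] with k hk
    rwa [Real.norm_of_nonneg (hf _), Real.norm_of_nonneg (hf _)]
  exact ⟨∑' k, f k, tsum_nonneg hf, fun k => hs.le_tsum k fun j _ => hf j⟩

/-- The Pochhammer symbol grows at most like `k! t⁻ᵏ` for every `t < 1`. -/
lemma exists_bound_poch (a : ℂ) {t : ℝ} (ht : 0 < t) (ht1 : t < 1) :
    ∃ C, 0 ≤ C ∧ ∀ k : ℕ, ‖poch a k‖ * t ^ k / k.factorial ≤ C := by
  obtain ⟨r, htr, hr1⟩ := exists_between ht1
  refine exists_bound_of_eventually_ratio_le (fun k => by positivity) hr1 ?_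
  filter_upwards [tendsto_natCast_atTop_atTop.eventually_ge_atTop (‖a‖ * t / (r - t))] with k hk
  rw [div_le_iff₀ (by linarith)] at hk
  have hak : ‖a + k‖ ≤ ‖a‖ + k := (norm_add_le _ _).trans_eq (by simp)
  have h1 : ‖a + k‖ * t ≤ r * (k + 1) := by nlinarith
  rw [poch_succ, norm_mul, Nat.factorial_succ, pow_succ]
  push_cast
  calc ‖poch a k‖ * ‖a + k‖ * (t ^ k * t) / ((k + 1) * k.factorial)
      = (‖a + k‖ * t / (k + 1)) * (‖poch a k‖ * t ^ k / k.factorial) := by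
        field_simp
    _ ≤ r * (‖poch a k‖ * t ^ k / k.factorial) := by
        gcongr
        rwa [div_le_iff₀ (by positivity)]

/-- The inverse Pochhammer symbol is at most of order `t⁻ᵏ / k!` for every `t < 1`. -/
lemma exists_bound_inv_poch (a : ℂ) {t : ℝ} (ht : 0 < t) (ht1 : t < 1) :
    ∃ C, 0 ≤ C ∧ ∀ k : ℕ, k.factorial * t ^ k / ‖poch a k‖ ≤ C := by
  obtain ⟨r, htr, hr1⟩ := exists_between ht1
  refine exists_bound_of_eventually_ratio_le (fun k => by positivity) hr1 ?_
  filter_upwards [tendsto_natCast_atTop_atTop.eventually_ge_atTop ((t + ‖a‖) / (r - t)),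
    tendsto_natCast_atTop_atTop.eventually_gt_atTop ‖a‖] with k hk hk'
  rw [div_le_iff₀ (by linarith)] at hk
  have hak : (k : ℝ) - ‖a‖ ≤ ‖a + k‖ := by
    have := norm_sub_norm_le (k : ℂ) (-a)
    rw [sub_neg_eq_add, add_comm (k : ℂ), norm_neg, Complex.norm_natCast] at this
    exact this
  have hpos : 0 < ‖a + k‖ := by linarith
  have h1 : (k + 1) * t ≤ r * ‖a + k‖ := by nlinarith [norm_nonneg a]
  rw [poch_succ, norm_mul, Nat.factorial_succ, pow_succ]
  push_cast
  calc (k + 1) * k.factorial * (t ^ k * t) / (‖poch a k‖ * ‖a + k‖)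
      = ((k + 1) * t / ‖a + k‖) * (k.factorial * t ^ k / ‖poch a k‖) := by
        rw [div_mul_div_comm]; ring
    _ ≤ r * (k.factorial * t ^ k / ‖poch a k‖) := by
        gcongr
        rwa [div_le_iff₀ hpos]

/-- The coefficients of Appell's series `F₄`. -/
def appellF4Coeff (μ lam0 lam1 lam2 : ℂ) (p : ℕ × ℕ) : ℂ :=
  poch μ (p.1 + p.2) * poch lam0 (p.1 + p.2) /
    (poch lam1 p.1 * poch lam2 p.2 * (Nat.factorial p.1 : ℂ) * (Nat.factorial p.2 : ℂ))

lemma choose_mul_pow_mul_pow_le {a b : ℝ} (ha : 0 ≤ a) (hb : 0 ≤ b) (m n : ℕ) :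
    ((m + n).choose m : ℝ) * (a ^ m * b ^ n) ≤ (a + b) ^ (m + n) := by
  rw [add_pow]
  have := Finset.single_le_sum (s := Finset.range (m + n + 1)) (a := m)
    (f := fun k => a ^ k * b ^ (m + n - k) * ((m + n).choose k : ℝ))
    (fun k _ => by positivity) (by simp)
  simp only [Nat.add_sub_cancel_left] at this
  linarith

lemma summable_pow_add {t : ℝ} (ht : 0 ≤ t) (ht1 : t < 1) :
    Summable fun p : ℕ × ℕ => t ^ (p.1 + p.2) := by
  simp only [pow_add]
  have h := summable_geometric_of_lt_one ht ht1
  exact h.mul_of_nonneg h (fun _ => by positivity) (fun _ => by positivity)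

lemma summable_appellF4 (μ lam0 lam1 lam2 : ℂ) {x y : ℂ}
    (h : Real.sqrt ‖x‖ + Real.sqrt ‖y‖ < 1) :
    Summable fun p : ℕ × ℕ => ‖appellF4Coeff μ lam0 lam1 lam2 p * x ^ p.1 * y ^ p.2‖ := by
  set a := Real.sqrt ‖x‖
  set b := Real.sqrt ‖y‖
  have ha : 0 ≤ a := Real.sqrt_nonneg _
  have hb : 0 ≤ b := Real.sqrt_nonneg _
  have hxa : ‖x‖ = a ^ 2 := (Real.sq_sqrt (norm_nonneg _)).symm
  have hyb : ‖y‖ = b ^ 2 := (Real.sq_sqrt (norm_nonneg _)).symm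
  obtain ⟨T, hT, hT1⟩ := exists_between h
  have hT0 : 0 < T := by linarith
  obtain ⟨t, ht, rfl⟩ : ∃ t, 0 < t ∧ t ^ 2 = T :=
    ⟨Real.sqrt T, Real.sqrt_pos.2 hT0, Real.sq_sqrt hT0.le⟩
  have ht1 : t < 1 := by nlinarith
  obtain ⟨C₁, hC₁, h₁⟩ := exists_bound_poch μ ht ht1
  obtain ⟨C₂, hC₂, h₂⟩ := exists_bound_poch lam0 ht ht1
  obtain ⟨C₃, hC₃, h₃⟩ := exists_bound_inv_poch lam1 ht ht1
  obtain ⟨C₄, hC₄, h₄⟩ := exists_bound_inv_poch lam2 ht ht1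
  refine Summable.of_nonneg_of_le (fun _ => norm_nonneg _) ?_
    ((summable_pow_add ht.le ht1).mul_left (C₁ * C₂ * C₃ * C₄))
  rintro ⟨m, n⟩
  have hch : ((m + n).choose m : ℝ) * m.factorial * n.factorial = (m + n).factorial := by
    rw [Nat.choose_symm_add]
    exact_mod_cast Nat.add_choose_mul_factorial_mul_factorial m n
  have hbin : ((m + n).choose m : ℝ) * (a ^ m * b ^ n) ≤ (t ^ 2) ^ (m + n) :=
    (choose_mul_pow_mul_pow_le ha hb m n).trans (by gcongr)
  have key : ‖appellF4Coeff μ lam0 lam1 lam2 (m, n) * x ^ m * y ^ n‖ * t ^ (3 * (m + n)) =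
      (‖poch μ (m + n)‖ * t ^ (m + n) / (m + n).factorial) *
      (‖poch lam0 (m + n)‖ * t ^ (m + n) / (m + n).factorial) *
      (m.factorial * t ^ m / ‖poch lam1 m‖) * (n.factorial * t ^ n / ‖poch lam2 n‖) *
      (((m + n).choose m : ℝ) * (a ^ m * b ^ n)) ^ 2 := by
    have hc : ((m + n).choose m : ℝ) ≠ 0 := by
      exact_mod_cast (Nat.choose_pos (Nat.le_add_right m n)).ne'
    simp only [appellF4Coeff, norm_mul, norm_div, norm_pow, Complex.norm_natCast, hxa, hyb, ← hch]
    simp only [div_eq_mul_inv, mul_inv]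
    field_simp
    ring
  have hle : ‖appellF4Coeff μ lam0 lam1 lam2 (m, n) * x ^ m * y ^ n‖ * t ^ (3 * (m + n)) ≤
      C₁ * C₂ * C₃ * C₄ * ((t ^ 2) ^ (m + n)) ^ 2 := by
    rw [key]
    have := h₁ (m + n)
    have := h₂ (m + n)
    have := h₃ m
    have := h₄ n
    gcongr
  refine le_of_mul_le_mul_right (hle.trans_eq ?_) (pow_pos ht (3 * (m + n)))
  ring

/-- `w` is the sum of the double power series with coefficients `c` on the domain
`√‖x‖ + √‖y‖ < 1`. -/
def HasDoubleSeries (w : ℂ → ℂ → ℂ) (c : ℕ × ℕ → ℂ) : Prop :=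
  ∀ x y : ℂ, Real.sqrt ‖x‖ + Real.sqrt ‖y‖ < 1 →
    HasSum (fun p : ℕ × ℕ => c p * x ^ p.1 * y ^ p.2) (w x y)

lemma exists_larger_polyradius {x y : ℂ} (h : Real.sqrt ‖x‖ + Real.sqrt ‖y‖ < 1) :
    ∃ R S : ℝ, ‖x‖ < R ∧ ‖y‖ < S ∧ Real.sqrt R + Real.sqrt S < 1 := by
  have hc : ContinuousAt (fun t : ℝ => Real.sqrt (‖x‖ + t) + Real.sqrt (‖y‖ + t)) 0 := by
    fun_prop
  have h0 : ∀ᶠ t in 𝓝[>] (0 : ℝ), Real.sqrt (‖x‖ + t) + Real.sqrt (‖y‖ + t) < 1 :=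
    (hc.eventually_lt_const (by simpa using h)).filter_mono nhdsWithin_le_nhds
  obtain ⟨t, ht, ht0⟩ := (h0.and self_mem_nhdsWithin).exists
  exact ⟨‖x‖ + t, ‖y‖ + t, by simpa using ht0, by simpa using ht0, ht⟩

lemma sqrt_add_sqrt_lt_one_mono {a b R S : ℝ} (ha : a ≤ R) (hb : b ≤ S)
    (h : Real.sqrt R + Real.sqrt S < 1) : Real.sqrt a + Real.sqrt b < 1 :=
  (add_le_add (Real.sqrt_le_sqrt ha) (Real.sqrt_le_sqrt hb)).trans_lt h

namespace HasDoubleSeries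

variable {w w' : ℂ → ℂ → ℂ} {c c' : ℕ × ℕ → ℂ}

lemma summable_bound (h : HasDoubleSeries w c) {R S : ℝ} (hR : 0 ≤ R) (hS : 0 ≤ S)
    (hRS : Real.sqrt R + Real.sqrt S < 1) :
    Summable fun p : ℕ × ℕ => ‖c p‖ * R ^ p.1 * S ^ p.2 := by
  have := (h R S (by simpa [abs_of_nonneg hR, abs_of_nonneg hS] using hRS)).summable.norm
  simpa [abs_of_nonneg hR, abs_of_nonneg hS] using this

lemma add (h : HasDoubleSeries w c) (h' : HasDoubleSeries w' c') :
    HasDoubleSeries (fun x y => w x y + w' x y) (fun p => c p + c' p) := fun x y hxy => by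
  simpa only [add_mul] using (h x y hxy).add (h' x y hxy)

lemma const_mul (h : HasDoubleSeries w c) (a : ℂ) :
    HasDoubleSeries (fun x y => a * w x y) (fun p => a * c p) := fun x y hxy => by
  simpa only [mul_assoc] using (h x y hxy).mul_left a

lemma swap (h : HasDoubleSeries w c) :
    HasDoubleSeries (fun x y => w y x) (fun p => c p.swap) := fun x y hxy => by
  have := (Equiv.prodComm ℕ ℕ).hasSum_iff.2 (h y x (by rwa [add_comm]))
  convert! this using 2 with p
  simp
  ring

lemma differentiableAt_and_hasSum (h : HasDoubleSeries w c) {x y : ℂ}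
    (hxy : Real.sqrt ‖x‖ + Real.sqrt ‖y‖ < 1) :
    DifferentiableAt ℂ (fun x' => w x' y) x ∧
      HasSum (fun p : ℕ × ℕ => c p * (p.1 * x ^ (p.1 - 1)) * y ^ p.2) (dx w x y) := by
  obtain ⟨R, S, hR, hS, hRS⟩ := exists_larger_polyradius hxy
  have hR0 : 0 ≤ R := (norm_nonneg _).trans hR.le
  have hS0 : 0 ≤ S := (norm_nonneg _).trans hS.le
  have hx : x ∈ Metric.ball (0 : ℂ) R := by simpa using hR
  have hsum := h.summable_bound hR0 hS0 hRS
  have hdiff : ∀ p : ℕ × ℕ,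
      DifferentiableOn ℂ (fun z : ℂ => c p * z ^ p.1 * y ^ p.2) (Metric.ball 0 R) :=
    fun p => by fun_prop
  have hle : ∀ (p : ℕ × ℕ) (z : ℂ), z ∈ Metric.ball (0 : ℂ) R →
      ‖c p * z ^ p.1 * y ^ p.2‖ ≤ ‖c p‖ * R ^ p.1 * S ^ p.2 := fun p z hz => by
    rw [norm_mul, norm_mul, norm_pow, norm_pow]
    have hz : ‖z‖ < R := by simpa using hz
    gcongr
  have heq : (fun z => w z y) =ᶠ[𝓝 x] fun z => ∑' p : ℕ × ℕ, c p * z ^ p.1 * y ^ p.2 := by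
    filter_upwards [Metric.isOpen_ball.mem_nhds hx] with z hz
    have hz : ‖z‖ < R := by simpa using hz
    exact (h z y (sqrt_add_sqrt_lt_one_mono hz.le hS.le hRS)).tsum_eq.symm
  constructor
  · exact ((differentiableOn_tsum_of_summable_norm hsum hdiff Metric.isOpen_ball
      hle).differentiableAt (Metric.isOpen_ball.mem_nhds hx)).congr_of_eventuallyEq heq
  · have := hasSum_deriv_of_summable_norm hsum hdiff Metric.isOpen_ball hle hx
    rw [← heq.deriv_eq] at this
    simpa [_root_.dx] using this

lemma hasDerivAt_fst (h : HasDoubleSeries w c) {x y : ℂ}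
    (hxy : Real.sqrt ‖x‖ + Real.sqrt ‖y‖ < 1) : HasDerivAt (fun x' => w x' y) (dx w x y) x :=
  (h.differentiableAt_and_hasSum hxy).1.hasDerivAt

lemma hasDerivAt_snd (h : HasDoubleSeries w c) {x y : ℂ}
    (hxy : Real.sqrt ‖x‖ + Real.sqrt ‖y‖ < 1) : HasDerivAt (fun y' => w x y') (dy w x y) y :=
  h.swap.hasDerivAt_fst (by rwa [add_comm])

lemma dx (h : HasDoubleSeries w c) :
    HasDoubleSeries (dx w) (fun p => (p.1 + 1) * c (p.1 + 1, p.2)) := fun x y hxy => by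
  have hinj : Function.Injective fun p : ℕ × ℕ => (p.1 + 1, p.2) := by
    rintro ⟨a, b⟩ ⟨a', b'⟩ hab
    simpa using hab
  have := (hinj.hasSum_iff ?_).2 (h.differentiableAt_and_hasSum hxy).2
  · convert! this using 2 with p
    simp only [Function.comp_apply, Nat.add_sub_cancel]
    push_cast
    ring
  · rintro ⟨_ | m, n⟩ hp
    · simp
    · exact absurd ⟨(m, n), rfl⟩ hp

lemma dy (h : HasDoubleSeries w c) :
    HasDoubleSeries (dy w) (fun p => (p.2 + 1) * c (p.1, p.2 + 1)) :=
  h.swap.dx.swap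

lemma thx (h : HasDoubleSeries w c) :
    HasDoubleSeries (thx w) (fun p => p.1 * c p) := fun x y hxy => by
  change HasSum _ (x * _root_.dx w x y)
  convert! (h.differentiableAt_and_hasSum hxy).2.mul_left x using 2 with p
  rcases p with ⟨_ | m, n⟩
  · simp
  · simp
    ring

lemma thy (h : HasDoubleSeries w c) :
    HasDoubleSeries (thy w) (fun p => p.2 * c p) :=
  h.swap.thx.swap

lemma eq_zero (h : HasDoubleSeries w c) (hc : ∀ p, c p = 0) {x y : ℂ}
    (hxy : Real.sqrt ‖x‖ + Real.sqrt ‖y‖ < 1) : w x y = 0 :=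
  (h x y hxy).unique (by simp [hc])

lemma continuousAt (h : HasDoubleSeries w c) {q : ℂ × ℂ}
    (hq : Real.sqrt ‖q.1‖ + Real.sqrt ‖q.2‖ < 1) :
    ContinuousAt (fun q : ℂ × ℂ => w q.1 q.2) q := by
  obtain ⟨R, S, hR, hS, hRS⟩ := exists_larger_polyradius hq
  have hR0 : 0 ≤ R := (norm_nonneg _).trans hR.le
  have hS0 : 0 ≤ S := (norm_nonneg _).trans hS.le
  have hU : {q : ℂ × ℂ | ‖q.1‖ < R ∧ ‖q.2‖ < S} ∈ 𝓝 q :=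
    (continuous_fst.norm.continuousAt.eventually_lt_const hR).and
      (continuous_snd.norm.continuousAt.eventually_lt_const hS)
  have hcont : ContinuousOn (fun q : ℂ × ℂ => ∑' p : ℕ × ℕ, c p * q.1 ^ p.1 * q.2 ^ p.2)
      {q : ℂ × ℂ | ‖q.1‖ < R ∧ ‖q.2‖ < S} := by
    refine continuousOn_tsum (fun p => by fun_prop) (h.summable_bound hR0 hS0 hRS) ?_
    rintro p z ⟨hz1, hz2⟩
    rw [norm_mul, norm_mul, norm_pow, norm_pow]
    gcongr
  refine (hcont.continuousAt hU).congr ?_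
  filter_upwards [hU] with z hz
  exact (h _ _ (sqrt_add_sqrt_lt_one_mono hz.1.le hz.2.le hRS)).tsum_eq

lemma differentiableAt (h : HasDoubleSeries w c) {q : ℂ × ℂ}
    (hq : Real.sqrt ‖q.1‖ + Real.sqrt ‖q.2‖ < 1) :
    DifferentiableAt ℂ (fun q : ℂ × ℂ => w q.1 q.2) q := by
  have hev : ∀ᶠ v : ℂ × ℂ in 𝓝 q, Real.sqrt ‖v.1‖ + Real.sqrt ‖v.2‖ < 1 :=
    (isOpen_lt (by fun_prop) (by fun_prop)).mem_nhds hq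
  exact (hasStrictFDerivAt_uncurry_coprod (f := w)
    (f₁ := fun x y => ContinuousLinearMap.toSpanSingleton ℂ (_root_.dx w x y))
    (f₂ := fun x y => ContinuousLinearMap.toSpanSingleton ℂ (_root_.dy w x y))
    (hev.mono fun v hv => (h.hasDerivAt_fst hv).hasFDerivAt)
    (hev.mono fun v hv => (h.hasDerivAt_snd hv).hasFDerivAt)
    ((ContinuousLinearMap.toSpanSingletonCLE (𝕜 := ℂ) (E := ℂ)).continuous.continuousAt.comp
      (h.dx.continuousAt hq))
    ((ContinuousLinearMap.toSpanSingletonCLE (𝕜 := ℂ) (E := ℂ)).continuous.continuousAt.comp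
      (h.dy.continuousAt hq))).differentiableAt

end HasDoubleSeries

lemma appellF4Coeff_succ_fst (μ lam0 lam1 lam2 : ℂ) (m n : ℕ) (h : lam1 + m ≠ 0) :
    (m + 1) * (lam1 + m) * appellF4Coeff μ lam0 lam1 lam2 (m + 1, n) =
      (μ + (m + n)) * (lam0 + (m + n)) * appellF4Coeff μ lam0 lam1 lam2 (m, n) := by
  have hm : (m + 1 : ℂ) ≠ 0 := by exact_mod_cast m.succ_ne_zero
  simp only [appellF4Coeff, Nat.add_right_comm m 1 n, poch_succ, Nat.factorial_succ,
    div_eq_mul_inv, mul_inv]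
  push_cast
  simp only [mul_inv]
  field_simp

lemma appellF4Coeff_swap (μ lam0 lam1 lam2 : ℂ) (p : ℕ × ℕ) :
    appellF4Coeff μ lam0 lam1 lam2 p.swap = appellF4Coeff μ lam0 lam2 lam1 p := by
  simp only [appellF4Coeff, Prod.fst_swap, Prod.snd_swap, add_comm p.2 p.1]
  ring

lemma appellF4Coeff_succ_snd (μ lam0 lam1 lam2 : ℂ) (m n : ℕ) (h : lam2 + n ≠ 0) :
    (n + 1) * (lam2 + n) * appellF4Coeff μ lam0 lam1 lam2 (m, n + 1) =
      (μ + (m + n)) * (lam0 + (m + n)) * appellF4Coeff μ lam0 lam1 lam2 (m, n) := by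
  have := appellF4Coeff_succ_fst μ lam0 lam2 lam1 n m h
  rwa [← appellF4Coeff_swap μ lam0 lam1 lam2 (n + 1, m), ← appellF4Coeff_swap μ lam0 lam1 lam2 (n, m),
    add_comm (n : ℂ) m] at this

theorem stmt15 (μ lam0 lam1 lam2 : ℂ)
    (hlam1 : ∀ k : ℤ, k ≤ 0 → lam1 ≠ (k : ℂ))
    (hlam2 : ∀ k : ℤ, k ≤ 0 → lam2 ≠ (k : ℂ))
    (u : ℂ → ℂ → ℂ)
    (hu : u = fun x y => ∑' p : ℕ × ℕ,
      poch μ (p.1 + p.2) * poch lam0 (p.1 + p.2) /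
          (poch lam1 p.1 * poch lam2 p.2 * (Nat.factorial p.1 : ℂ) *
            (Nat.factorial p.2 : ℂ)) *
        x ^ p.1 * y ^ p.2) :
    (∀ x y : ℂ, Real.sqrt ‖x‖ + Real.sqrt ‖y‖ < 1 →
      Summable (fun p : ℕ × ℕ =>
        ‖poch μ (p.1 + p.2) * poch lam0 (p.1 + p.2) /
            (poch lam1 p.1 * poch lam2 p.2 * (Nat.factorial p.1 : ℂ) *
              (Nat.factorial p.2 : ℂ)) *
          x ^ p.1 * y ^ p.2‖)) ∧
    DifferentiableOn ℂ (fun p : ℂ × ℂ => u p.1 p.2)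
      {p : ℂ × ℂ | Real.sqrt ‖p.1‖ + Real.sqrt ‖p.2‖ < 1} ∧
    (∀ x y : ℂ, Real.sqrt ‖x‖ + Real.sqrt ‖y‖ < 1 →
      thx (fun x y => thx u x y + thy u x y + lam0 * u x y) x y +
          thy (fun x y => thx u x y + thy u x y + lam0 * u x y) x y +
          μ * (thx u x y + thy u x y + lam0 * u x y) -
          dx (fun x y => thx u x y + (lam1 - 1) * u x y) x y = 0) ∧
    (∀ x y : ℂ, Real.sqrt ‖x‖ + Real.sqrt ‖y‖ < 1 →
      thx (fun x y => thx u x y + thy u x y + lam0 * u x y) x y +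
          thy (fun x y => thx u x y + thy u x y + lam0 * u x y) x y +
          μ * (thx u x y + thy u x y + lam0 * u x y) -
          dy (fun x y => thy u x y + (lam2 - 1) * u x y) x y = 0) := by
  have hne : ∀ {a : ℂ}, (∀ k : ℤ, k ≤ 0 → a ≠ (k : ℂ)) → ∀ m : ℕ, a + m ≠ 0 := fun ha m h0 =>
    ha (-m) (by simp) (by push_cast; exact eq_neg_of_add_eq_zero_left h0)
  have hs : HasDoubleSeries u (appellF4Coeff μ lam0 lam1 lam2) := fun x y hxy => by
    rw [hu]
    exact (summable_appellF4 μ lam0 lam1 lam2 hxy).of_norm.hasSum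
  have hv := (hs.thx.add hs.thy).add (hs.const_mul lam0)
  have hL := (hv.thx.add hv.thy).add (hv.const_mul μ)
  refine ⟨fun x y hxy => summable_appellF4 μ lam0 lam1 lam2 hxy,
    fun q hq => (hs.differentiableAt hq).differentiableWithinAt, fun x y hxy => ?_,
    fun x y hxy => ?_⟩
  · have hR := (hs.thx.add (hs.const_mul (lam1 - 1))).dx
    rw [sub_eq_add_neg, ← neg_one_mul]
    refine (hL.add (hR.const_mul (-1))).eq_zero ?_ hxy
    rintro ⟨m, n⟩
    have := appellF4Coeff_succ_fst μ lam0 lam1 lam2 m n (hne hlam1 m)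
    push_cast
    linear_combination -this
  · have hR := (hs.thy.add (hs.const_mul (lam2 - 1))).dy
    rw [sub_eq_add_neg, ← neg_one_mul]
    refine (hL.add (hR.const_mul (-1))).eq_zero ?_ hxy
    rintro ⟨m, n⟩
    have := appellF4Coeff_succ_snd μ lam0 lam1 lam2 m n (hne hlam2 n)
    push_cast
    linear_combination -this
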